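/- Let Λ be an artinian ring with Jacobson radical J, and suppose there exists a right Λ-module T of finite syzygy type such that Λ/J, viewed as a right Λ-module, embeds into T. For each m ≥ 0, let s_m denote the syzygy type of Ω^m(T). Then l Fin dim Λ ≤ s_m + m for all m ≥ 0. -/

import Mathlib

open CategoryTheory

universe u

section Preamble

variable (R : Type u) [Ring R]

/-- `PdimLE R n M` : the left `R`-module `M` has projective dimension at most `n`,
i.e. it admits a projective resolution of length at most `n`. -/
def PdimLE : ℕ → ModuleCat.{u} R → Prop
  | 0, M => Module.Projective R M
  | n + 1, M =>
    ∃ (P : ModuleCat.{u} R) (f : ↥P →ₗ[R] ↥M),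
      Module.Projective R ↥P ∧ Function.Surjective f ∧
        PdimLE n (ModuleCat.of R (LinearMap.ker f))

/-- `M` has projective dimension exactly `d`. -/
def PdimEq (M : ModuleCat.{u} R) (d : ℕ) : Prop :=
  PdimLE R d M ∧ ∀ k, PdimLE R k M → d ≤ k

/-- The projective dimension of `M`, as an element of `ℕ∞` (`⊤` = infinite). -/
noncomputable def pdim (M : ModuleCat.{u} R) : ℕ∞ :=
  sInf {d : ℕ∞ | ∃ n : ℕ, d = n ∧ PdimLE R n M}

/-- `IdimLE R n M` : the left `R`-module `M` has injective dimension at most `n`. -/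
def IdimLE : ℕ → ModuleCat.{u} R → Prop
  | 0, M => Module.Injective R M
  | n + 1, M =>
    ∃ (E : ModuleCat.{u} R) (f : ↥M →ₗ[R] ↥E),
      Module.Injective R ↥E ∧ Function.Injective f ∧
        IdimLE n (ModuleCat.of R (↥E ⧸ LinearMap.range f))

/-- The injective dimension of `M`, as an element of `ℕ∞`. -/
noncomputable def idim (M : ModuleCat.{u} R) : ℕ∞ :=
  sInf {d : ℕ∞ | ∃ n : ℕ, d = n ∧ IdimLE R n M}

/-- The (left) big finitistic dimension of `R`: the supremum of the projective
dimensions of all (left) `R`-modules of finite projective dimension. -/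
noncomputable def bigFinDim : ℕ∞ :=
  sSup {d : ℕ∞ | d ≠ ⊤ ∧ ∃ M : ModuleCat.{u} R, pdim R M = d}

/-- The (left) little finitistic dimension of `R`: the supremum of the projective
dimensions of all finitely generated (left) `R`-modules of finite projective dimension. -/
noncomputable def littleFinDim : ℕ∞ :=
  sSup {d : ℕ∞ | d ≠ ⊤ ∧ ∃ M : ModuleCat.{u} R, Module.Finite R ↥M ∧ pdim R M = d}

/-- The (left) global dimension of `R`, as an element of `ℕ∞`. -/
noncomputable def glDim : ℕ∞ :=
  sInf {d : ℕ∞ | ∃ n : ℕ, d = n ∧ ∀ M : ModuleCat.{u} R, PdimLE R n M}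

/-- `A` is (isomorphic to) a direct summand of `B`. -/
def IsSummand (A B : ModuleCat.{u} R) : Prop :=
  ∃ C : ModuleCat.{u} R, Nonempty ((↥A × ↥C) ≃ₗ[R] ↥B)

/-- A minimal projective resolution of `M`, recorded through its syzygies:
`Ω 0 ≅ M`, and for each `n` the map `f n : P n → Ω n` is a projective cover
(i.e. `P n` is projective, `f n` is surjective and its kernel is superfluous in `P n`),
with `Ω (n+1) ≅ ker (f n)`. -/
structure SyzygyChain (M : ModuleCat.{u} R) : Type (u + 1) where
  Ω : ℕ → ModuleCat.{u} R
  P : ℕ → ModuleCat.{u} R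
  projective : ∀ n, Module.Projective R ↥(P n)
  f : ∀ n, ↥(P n) →ₗ[R] ↥(Ω n)
  surj : ∀ n, Function.Surjective (f n)
  minimal : ∀ n, ∀ N : Submodule R ↥(P n), N ⊔ LinearMap.ker (f n) = ⊤ → N = ⊤
  iso0 : Nonempty (↥(Ω 0) ≃ₗ[R] ↥M)
  isoSucc : ∀ n, Nonempty (↥(Ω (n + 1)) ≃ₗ[R] ↥(LinearMap.ker (f n)))

/-- The minimal projective resolution is repetitive at degree `k`: the `k`-th
syzygy decomposes as `P ⊕ ⨁ᵢ Aᵢ` with `P` projective and each `Aᵢ` a direct summand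
of infinitely many syzygies. -/
def RepAt {M : ModuleCat.{u} R} (c : SyzygyChain R M) (k : ℕ) : Prop :=
  ∃ (ι : Type u) (A : ι → ModuleCat.{u} R) (P : ModuleCat.{u} R),
    Module.Projective R ↥P ∧
    (∀ i, {j : ℕ | IsSummand R (A i) (c.Ω j)}.Infinite) ∧
    Nonempty (↥(c.Ω k) ≃ₗ[R] (↥P × DirectSum ι fun i => ↥(A i)))

/-- The repetition index of a module (with a given minimal projective resolution),
as an element of `ℕ∞`. -/
noncomputable def repIndex {M : ModuleCat.{u} R} (c : SyzygyChain R M) : ℕ∞ :=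
  sInf {d : ℕ∞ | ∃ k : ℕ, d = k ∧ RepAt R c k}

/-- The (left) global repetition index of `R`. -/
noncomputable def glRep : ℕ∞ :=
  sSup {d : ℕ∞ | ∃ (M : ModuleCat.{u} R) (c : SyzygyChain R M), repIndex R c = d}

/-- The syzygy category of `M` (given a minimal projective resolution `c` of `M`)
is a Krull-Schmidt category of finite representation type, with the `s` modules
`A 0, …, A (s-1)` as representatives of the isomorphism classes of its nonzero
indecomposable objects: the `A i` have local endomorphism rings, are pairwise
non-isomorphic, each occurs as a direct summand of some syzygy, and every syzygy
is a finite direct sum of copies of the `A i`. -/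
def HasSyzygyType {M : ModuleCat.{u} R} (c : SyzygyChain R M) (s : ℕ)
    (A : Fin s → ModuleCat.{u} R) : Prop :=
  (∀ i, IsLocalRing (Module.End R ↥(A i))) ∧
  (∀ i j : Fin s, i ≠ j → IsEmpty (↥(A i) ≃ₗ[R] ↥(A j))) ∧
  (∀ i, ∃ j, IsSummand R (A i) (c.Ω j)) ∧
  (∀ j, ∃ m : Fin s → ℕ, Nonempty (↥(c.Ω j) ≃ₗ[R] ((i : Fin s) → Fin (m i) → ↥(A i))))

/-- Truncating a minimal projective resolution of `M` gives a minimal projective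
resolution of the `m`-th syzygy of `M`. -/
def SyzygyChain.shift {M : ModuleCat.{u} R} (c : SyzygyChain R M) (m : ℕ) :
    SyzygyChain R (c.Ω m) where
  Ω := fun j => c.Ω (m + j)
  P := fun j => c.P (m + j)
  projective := fun j => c.projective (m + j)
  f := fun j => c.f (m + j)
  surj := fun j => c.surj (m + j)
  minimal := fun j => c.minimal (m + j)
  iso0 := ⟨LinearEquiv.refl R ↥(c.Ω (m + 0))⟩
  isoSucc := fun j => c.isoSucc (m + j)

/-- The radical (Jacobson radical) of `R` as a left module over itself:
the intersection of all maximal submodules. -/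
def ringRadical : Submodule R R := sInf {m : Submodule R R | IsCoatom m}

/-- `R / rad R` as a left `R`-module. -/
noncomputable abbrev radQuot : ModuleCat.{u} R := ModuleCat.of R (R ⧸ ringRadical R)

/-- `X` embeds into `T`. -/
def EmbedsIn (X T : ModuleCat.{u} R) : Prop := ∃ g : ↥X →ₗ[R] ↥T, Function.Injective g

/-- The homological contingency of `A` to `M` (with minimal projective resolution `c`)
equals the integer `z`: `z` is the greatest element of `{-1} ∪ {j | A is a direct
summand of Ω^j(M)}`.  (So `z = -1` iff `A` is a summand of no syzygy, and no such `z`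
exists iff the contingency is infinite.) -/
def ContEq {M : ModuleCat.{u} R} (c : SyzygyChain R M) (A : ModuleCat.{u} R) (z : ℤ) : Prop :=
  IsGreatest (insert (-1) ((fun j : ℕ => (j : ℤ)) '' {j | IsSummand R A (c.Ω j)})) z

/-- `E` is an injective envelope of `X`: `E` is injective and contains a copy of `X`
as an essential submodule. -/
def IsInjectiveEnvelopeOf (X E : ModuleCat.{u} R) : Prop :=
  ∃ f : ↥X →ₗ[R] ↥E, Module.Injective R ↥E ∧ Function.Injective f ∧
    ∀ N : Submodule R ↥E, N ≠ ⊥ → N ⊓ LinearMap.range f ≠ ⊥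

end Preamble

section RingTheory

variable {R : Type*} [Ring R]

open MulOpposite in
/-- Over an artinian ring, the radical is contained in the radical of the opposite ring. -/
theorem op_mem_jacobson_of_mem_jacobson [IsArtinianRing R] {a : R} (ha : a ∈ Ring.jacobson R) :
    op a ∈ Ring.jacobson Rᵐᵒᵖ := by
  rw [← Ideal.jacobson_bot, Ideal.mem_jacobson_iff]
  intro y
  have hay : a * y.unop ∈ Ring.jacobson R := Ideal.mul_mem_right _ _ ha
  obtain ⟨n, hn⟩ := IsSemiprimaryRing.isNilpotent (R := R)
  have hnil : IsNilpotent (a * y.unop) :=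
    ⟨n, by simpa [hn] using Ideal.pow_mem_pow hay n⟩
  obtain ⟨u, hu⟩ := hnil.isUnit_one_add
  refine ⟨op (↑u⁻¹ : R), ?_⟩
  have h := u.mul_inv
  rw [hu, add_mul, one_mul] at h
  rw [Ideal.mem_bot, sub_eq_zero]
  apply unop_injective
  simpa [mul_assoc, add_comm] using h

open MulOpposite in
theorem mem_jacobson_of_op_mem_jacobson [IsArtinianRing Rᵐᵒᵖ] {a : R}
    (ha : op a ∈ Ring.jacobson Rᵐᵒᵖ) : a ∈ Ring.jacobson R := by
  have h := op_mem_jacobson_of_mem_jacobson ha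
  have : RingHomSurjective (RingEquiv.opOp R).symm.toRingHom :=
    ⟨(RingEquiv.opOp R).symm.surjective⟩
  exact Ring.le_comap_jacobson (RingEquiv.opOp R).symm.toRingHom h

variable {P Q : Type*} [AddCommGroup P] [Module R P] [AddCommGroup Q] [Module R Q]

/-- An endomorphism whose range lies in `JM`, with `J` nilpotent, is nilpotent. -/
theorem isNilpotent_of_range_le_jacobson_smul [IsSemiprimaryRing R] (g : Module.End R P)
    (hg : LinearMap.range g ≤ Ring.jacobson R • (⊤ : Submodule R P)) : IsNilpotent g := by
  obtain ⟨n, hn⟩ := IsSemiprimaryRing.isNilpotent (R := R)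
  have key : ∀ k, LinearMap.range (g ^ k) ≤ Ring.jacobson R ^ k • (⊤ : Submodule R P) := by
    intro k
    induction k with
    | zero => simp [Submodule.pow_zero, Ideal.one_eq_top]
    | succ k ih =>
      rw [pow_succ', Module.End.mul_eq_comp, LinearMap.range_comp, Submodule.pow_succ]
      refine (Submodule.map_mono ih).trans ?_
      rw [Submodule.map_smul'', Submodule.map_top, Submodule.mul_smul]
      exact Submodule.smul_mono le_rfl hg
  refine ⟨n, LinearMap.range_eq_bot.mp (le_bot_iff.mp ?_)⟩
  simpa [hn] using key n

theorem isSemisimpleModule_quotient_jacobson_smul [IsSemiprimaryRing R] :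
    IsSemisimpleModule R (P ⧸ (Ring.jacobson R • (⊤ : Submodule R P))) := by
  have hM : Module.IsTorsionBySet R (P ⧸ (Ring.jacobson R • (⊤ : Submodule R P)))
      (Ring.jacobson R) := by
    rintro x ⟨a, ha⟩
    induction x using Submodule.Quotient.induction_on with
    | _ x =>
      rw [← Submodule.Quotient.mk_smul, Submodule.Quotient.mk_eq_zero]
      exact Submodule.smul_mem_smul ha trivial
  let := hM.module
  exact hM.isSemisimpleModule_iff.mp inferInstance

/-- An injection between projective modules over a semiprimary ring that stays injective
modulo the radical splits. -/
theorem exists_leftInverse_of_jacobson_smul [IsSemiprimaryRing R] [Module.Projective R P]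
    [Module.Projective R Q] (i : P →ₗ[R] Q)
    (hi : ∀ x, i x ∈ Ring.jacobson R • (⊤ : Submodule R Q) →
      x ∈ Ring.jacobson R • (⊤ : Submodule R P)) :
    ∃ r : Q →ₗ[R] P, r ∘ₗ i = LinearMap.id := by
  set JP := Ring.jacobson R • (⊤ : Submodule R P) with hJP
  set JQ := Ring.jacobson R • (⊤ : Submodule R Q) with hJQ
  have hle : JP ≤ JQ.comap i := by
    rw [← Submodule.map_le_iff_le_comap, hJP, Submodule.map_smul'']
    exact Submodule.smul_mono le_rfl le_top
  let ibar : P ⧸ JP →ₗ[R] Q ⧸ JQ := JP.mapQ JQ i hle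
  have hker : LinearMap.ker ibar = ⊥ := by
    rw [LinearMap.ker_eq_bot']
    intro x hx
    induction x using Submodule.Quotient.induction_on with
    | _ x =>
      rw [Submodule.mapQ_apply, Submodule.Quotient.mk_eq_zero] at hx
      exact (Submodule.Quotient.mk_eq_zero _).mpr (hi x hx)
  have := isSemisimpleModule_quotient_jacobson_smul (R := R) (P := Q)
  obtain ⟨ρ, hρ⟩ := IsSemisimpleModule.extension_property ibar (LinearMap.ker_eq_bot.mp hker)
    LinearMap.id
  obtain ⟨r, hr⟩ := Module.projective_lifting_property JP.mkQ (ρ ∘ₗ JQ.mkQ) JP.mkQ_surjective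
  have hnil : IsNilpotent (LinearMap.id - r ∘ₗ i : Module.End R P) := by
    apply isNilpotent_of_range_le_jacobson_smul
    rintro _ ⟨x, rfl⟩
    rw [← hJP, ← Submodule.Quotient.mk_eq_zero]
    have h1 : JP.mkQ (r (i x)) = ρ (JQ.mkQ (i x)) := LinearMap.congr_fun hr (i x)
    have h2 : ρ (ibar (JP.mkQ x)) = JP.mkQ x := LinearMap.congr_fun hρ _
    change JP.mkQ (x - r (i x)) = 0
    rw [map_sub, h1, ← h2]
    exact sub_self _
  obtain ⟨u, hu⟩ := hnil.isUnit_one_sub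
  refine ⟨(↑u⁻¹ : Module.End R P) ∘ₗ r, ?_⟩
  have h := u.inv_mul
  have h3 : (1 - (LinearMap.id - r ∘ₗ i) : Module.End R P) = r ∘ₗ i := sub_sub_cancel _ _
  rw [hu, h3] at h
  exact h

end RingTheory

section CharacterDual

open MulOpposite

variable {R : Type*} [Ring R]

/-- The character module of a left module is a right module. -/
instance CharacterModule.instModuleMulOpposite (M : Type*) [AddCommGroup M] [Module R M] :
    Module Rᵐᵒᵖ (CharacterModule M) where
  smul a c := AddMonoidHom.comp c (DistribSMul.toAddMonoidHom M a.unop)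
  one_smul c := CharacterModule.ext _ fun x => congrArg c (one_smul R x)
  mul_smul a b c := CharacterModule.ext _ fun x => congrArg c (mul_smul b.unop a.unop x)
  smul_zero _ := rfl
  smul_add _ _ _ := rfl
  add_smul a b c := CharacterModule.ext _ fun x =>
    (congrArg c (add_smul a.unop b.unop x)).trans (map_add c _ _)
  zero_smul c := CharacterModule.ext _ fun x => (congrArg c (zero_smul R x)).trans (map_zero c)

variable {M N : Type*} [AddCommGroup M] [Module R M] [AddCommGroup N] [Module R N]

theorem CharacterModule.op_smul_apply (a : Rᵐᵒᵖ) (c : CharacterModule M) (x : M) :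
    (a • c) x = c (a.unop • x) := rfl

/-- Precomposition with a linear map, as a map of right modules. -/
def CharacterModule.opDual (f : M →ₗ[R] N) : CharacterModule N →ₗ[Rᵐᵒᵖ] CharacterModule M where
  toFun c := AddMonoidHom.comp c f.toAddMonoidHom
  map_add' _ _ := rfl
  map_smul' a c := CharacterModule.ext _ fun x => congrArg c (map_smul f a.unop x).symm

theorem CharacterModule.opDual_surjective (f : M →ₗ[R] N) (hf : Function.Injective f) :
    Function.Surjective (CharacterModule.opDual f) := fun c => by
  obtain ⟨d, hd⟩ := CharacterModule.dual_surjective_of_injective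
    f.toAddMonoidHom.toIntLinearMap hf c
  exact ⟨d, hd⟩

theorem CharacterModule.opDual_injective (f : M →ₗ[R] N) (hf : Function.Surjective f) :
    Function.Injective (CharacterModule.opDual f) := fun c d h => by
  refine CharacterModule.ext _ fun x => ?_
  obtain ⟨y, rfl⟩ := hf x
  exact DFunLike.congr_fun h y

theorem CharacterModule.opDual_exact (f : M →ₗ[R] N) (hf : Function.Surjective f) :
    Function.Exact (CharacterModule.opDual f)
      (CharacterModule.opDual (LinearMap.ker f).subtype) := by
  intro c
  constructor
  · intro hc
    have hle : f.toAddMonoidHom.ker ≤ AddMonoidHom.ker (G := M) (M := AddCircle (1 : ℚ)) c :=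
      fun x hx => DFunLike.congr_fun hc (⟨x, hx⟩ : LinearMap.ker f)
    refine ⟨f.toAddMonoidHom.liftOfSurjective hf ⟨c, hle⟩, CharacterModule.ext _ fun x => ?_⟩
    exact f.toAddMonoidHom.liftOfRightInverse_comp_apply _ (Function.rightInverse_surjInv hf)
      ⟨c, hle⟩ x
  · rintro ⟨d, rfl⟩
    refine CharacterModule.ext _ fun x => ?_
    exact (congrArg d x.2).trans (map_zero d)

/-- The character module of a projective module is injective. -/
theorem CharacterModule.injective_of_projective {R P : Type u} [Ring R] [AddCommGroup P]
    [Module R P] [Module.Projective R P] : Module.Injective Rᵐᵒᵖ (CharacterModule P) where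
  out X Y _ _ _ _ i hi g := by
    obtain ⟨s, hs⟩ := Module.projective_def.mp (inferInstance : Module.Projective R P)
    have hχ : ∀ p : P, ∃ χ : CharacterModule Y, ∀ x, χ (i x) = g x p := by
      intro p
      obtain ⟨χ, hχ⟩ := CharacterModule.opDual_surjective
        (R := ℤ) i.toAddMonoidHom.toIntLinearMap hi
        ((AddMonoidHom.eval p).comp (AddMonoidHomClass.toAddMonoidHom g :
          X →+ (P →+ AddCircle (1 : ℚ))))
      exact ⟨χ, fun x => DFunLike.congr_fun hχ x⟩
    choose χ hχ using hχ
    let ev (y : Y) : (P →₀ R) →+ AddCircle (1 : ℚ) := Finsupp.liftAddHom fun p =>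
      AddMonoidHom.comp (χ p) ((smulAddHom Rᵐᵒᵖ Y).flip y |>.comp opAddEquiv.toAddMonoidHom)
    have hev (y : Y) (l : P →₀ R) : ev y l = l.sum fun p a => χ p (op a • y) := rfl
    refine ⟨{ toFun := fun y => ((ev y).comp s.toAddMonoidHom : P →+ AddCircle (1 : ℚ))
              map_add' := ?_
              map_smul' := ?_ }, ?_⟩
    · intro y z
      refine CharacterModule.ext _ fun p => ?_
      change ev (y + z) (s p) = ev y (s p) + ev z (s p)
      simp only [hev, smul_add, map_add, Finsupp.sum_add]
    · intro a y
      refine CharacterModule.ext _ fun p => ?_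
      change ev (a • y) (s p) = ev y (s (a.unop • p))
      rw [map_smul]
      generalize s p = l
      induction l using Finsupp.induction_linear with
      | zero => simp
      | add l l' h h' => simp only [smul_add, map_add, h, h']
      | single p b =>
        rw [Finsupp.smul_single, hev, hev, Finsupp.sum_single_index (by simp),
          Finsupp.sum_single_index (by simp), smul_smul, smul_eq_mul, op_mul, op_unop]
    · intro x
      refine CharacterModule.ext _ fun p => ?_
      change ev (i x) (s p) = g x p
      conv_rhs => rw [← hs p]
      generalize s p = l
      induction l using Finsupp.induction_linear with
      | zero => simp
      | add l l' h h' => simp only [map_add, h, h']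
      | single p b =>
        rw [hev, Finsupp.sum_single_index (by simp), ← map_smul, hχ, map_smul]
        simp [CharacterModule.op_smul_apply]

end CharacterDual

section Ext

open Abelian

universe w v t

section Abelian

variable {C : Type t} [Category.{v} C] [Abelian C] [HasExt.{w} C] {S : ShortComplex C}

theorem subsingleton_ext_X₁_left (hS : S.ShortExact) (N : C) (n : ℕ)
    (h₂ : Subsingleton (Ext S.X₂ N n)) (h₃ : Subsingleton (Ext S.X₃ N (n + 1))) :
    Subsingleton (Ext S.X₁ N n) := by
  refine subsingleton_of_forall_eq 0 fun x => ?_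
  obtain ⟨y, rfl⟩ := Ext.contravariant_sequence_exact₁ hS N x (add_comm 1 n)
    (Subsingleton.elim _ _)
  rw [Subsingleton.elim y 0, Ext.comp_zero]

theorem subsingleton_ext_X₃_left (hS : S.ShortExact) (N : C) (n : ℕ)
    (h₁ : Subsingleton (Ext S.X₁ N n)) (h₂ : Subsingleton (Ext S.X₂ N (n + 1))) :
    Subsingleton (Ext S.X₃ N (n + 1)) := by
  refine subsingleton_of_forall_eq 0 fun x => ?_
  obtain ⟨y, rfl⟩ := Ext.contravariant_sequence_exact₃ hS N x (Subsingleton.elim _ _)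
    (add_comm 1 n)
  rw [Subsingleton.elim y 0, Ext.comp_zero]

theorem subsingleton_ext_X₃_right (hS : S.ShortExact) (X : C) (n : ℕ)
    (h₂ : Subsingleton (Ext X S.X₂ n)) (h₁ : Subsingleton (Ext X S.X₁ (n + 1))) :
    Subsingleton (Ext X S.X₃ n) := by
  refine subsingleton_of_forall_eq 0 fun x => ?_
  obtain ⟨y, rfl⟩ := Ext.covariant_sequence_exact₃ X hS x rfl (Subsingleton.elim _ _)
  rw [Subsingleton.elim y 0, Ext.zero_comp]

theorem subsingleton_ext_X₁_right (hS : S.ShortExact) (X : C) (n : ℕ)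
    (h₃ : Subsingleton (Ext X S.X₃ n)) (h₂ : Subsingleton (Ext X S.X₂ (n + 1))) :
    Subsingleton (Ext X S.X₁ (n + 1)) := by
  refine subsingleton_of_forall_eq 0 fun x => ?_
  obtain ⟨y, rfl⟩ := Ext.covariant_sequence_exact₁ X hS x (Subsingleton.elim _ _) rfl
  rw [Subsingleton.elim y 0, Ext.zero_comp]

theorem subsingleton_ext_of_retract {A B : C} (h : Retract A B) (N : C) (n : ℕ)
    (hB : Subsingleton (Ext B N n)) : Subsingleton (Ext A N n) := by
  refine subsingleton_of_forall_eq 0 fun x => ?_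
  rw [← Ext.mk₀_id_comp x, ← h.retract, ← Ext.mk₀_comp_mk₀_assoc,
    Subsingleton.elim ((Ext.mk₀ h.r).comp x (zero_add n)) 0, Ext.comp_zero]

/-- If `𝟙 B` is a finite sum of endomorphisms factoring through objects on which `Ext`
vanishes, then `Ext` vanishes on `B`. -/
theorem subsingleton_ext_of_sum_eq_id {ι : Type*} [Fintype ι] {B : C} (X : ι → C)
    (π : ∀ i, B ⟶ X i) (σ : ∀ i, X i ⟶ B) (hsum : ∑ i, π i ≫ σ i = 𝟙 B) (N : C) (n : ℕ)
    (h : ∀ i, Subsingleton (Ext (X i) N n)) : Subsingleton (Ext B N n) := by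
  refine subsingleton_of_forall_eq 0 fun x => ?_
  rw [← Ext.mk₀_id_comp x, ← hsum, Ext.mk₀_sum, Ext.sum_comp]
  refine Finset.sum_eq_zero fun i _ => ?_
  rw [← Ext.mk₀_comp_mk₀_assoc, Subsingleton.elim ((Ext.mk₀ (σ i)).comp x (zero_add n)) 0,
    Ext.comp_zero]

end Abelian

variable {R : Type u} [Ring R]

theorem ModuleCat.shortExact_of_exact {A B C : ModuleCat.{u} R} (f : ↥A →ₗ[R] ↥B)
    (g : ↥B →ₗ[R] ↥C) (hf : Function.Injective f) (hg : Function.Surjective g)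
    (h : Function.Exact f g) :
    (ShortComplex.mk (ModuleCat.ofHom f) (ModuleCat.ofHom g)
      (ModuleCat.hom_ext (LinearMap.ext h.apply_apply_eq_zero))).ShortExact where
  exact := (ShortComplex.ShortExact.moduleCat_exact_iff_function_exact _).mpr h
  mono_f := (ModuleCat.mono_iff_injective _).mpr hf
  epi_g := (ModuleCat.epi_iff_surjective _).mpr hg

/-- The character module of a left module, as an object of the category of right modules. -/
abbrev charDual (M : ModuleCat.{u} R) : ModuleCat.{u} Rᵐᵒᵖ :=
  ModuleCat.of Rᵐᵒᵖ (CharacterModule M)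

theorem charDual_shortExact {P M : ModuleCat.{u} R} (f : ↥P →ₗ[R] ↥M)
    (hf : Function.Surjective f) :
    (ShortComplex.mk
      (ModuleCat.ofHom (CharacterModule.opDual f) : charDual M ⟶ charDual P)
      (ModuleCat.ofHom (CharacterModule.opDual (LinearMap.ker f).subtype) :
        charDual P ⟶ charDual (ModuleCat.of R (LinearMap.ker f)))
      (ModuleCat.hom_ext (LinearMap.ext
        (CharacterModule.opDual_exact f hf).apply_apply_eq_zero))).ShortExact :=
  ModuleCat.shortExact_of_exact (A := charDual M) (B := charDual P)
    (C := charDual (ModuleCat.of R (LinearMap.ker f))) _ _ (CharacterModule.opDual_injective f hf)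
    (CharacterModule.opDual_surjective _ (Submodule.injective_subtype _))
    (CharacterModule.opDual_exact f hf)

theorem injective_charDual (P : ModuleCat.{u} R) [Module.Projective R P] :
    Injective (charDual P) :=
  Module.injective_object_of_injective_module
    (inj := CharacterModule.injective_of_projective (R := R) (P := P))

/-- `Ext` into the character dual of `M` vanishes above the projective dimension of `M`. -/
theorem subsingleton_ext_charDual {d : ℕ} {M : ModuleCat.{u} R} (hM : PdimLE R d M)
    (X : ModuleCat.{u} Rᵐᵒᵖ) {k : ℕ} (hk : d < k) : Subsingleton (Ext X (charDual M) k) := by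
  induction d generalizing M k with
  | zero =>
    have : Module.Projective R M := hM
    have := injective_charDual M
    obtain ⟨k, rfl⟩ := Nat.exists_eq_succ_of_ne_zero hk.ne'
    exact Ext.subsingleton_of_injective _ _ _
  | succ d ih =>
    obtain ⟨P, f, hP, hf, hK⟩ := hM
    obtain ⟨k, rfl⟩ := Nat.exists_eq_succ_of_ne_zero (Nat.ne_zero_of_lt hk)
    have := injective_charDual P
    exact subsingleton_ext_X₁_right (charDual_shortExact f hf) X k
      (ih hK (Nat.lt_of_succ_lt_succ hk)) (Ext.subsingleton_of_injective _ _ _)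

open MulOpposite in
/-- A module of projective dimension at most one is projective as soon as `Ext¹` from the top
of the ring into its character dual vanishes. -/
theorem projective_of_subsingleton_ext_one [IsArtinianRing R] [IsArtinianRing Rᵐᵒᵖ]
    {P M : ModuleCat.{u} R} (f : ↥P →ₗ[R] ↥M) (hf : Function.Surjective f)
    [Module.Projective R P] [Module.Projective R (LinearMap.ker f)]
    (h : Subsingleton (Ext (radQuot Rᵐᵒᵖ) (charDual M) 1)) : Module.Projective R M := by
  have hrad : ∀ x : LinearMap.ker f, (LinearMap.ker f).subtype x ∈
      Ring.jacobson R • (⊤ : Submodule R P) →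
      x ∈ Ring.jacobson R • (⊤ : Submodule R (LinearMap.ker f)) := by
    intro x hx
    set JK := Ring.jacobson R • (⊤ : Submodule R (LinearMap.ker f)) with hJK
    by_contra hxJ
    have hne : JK.mkQ x ≠ 0 := fun h0 => hxJ ((Submodule.Quotient.mk_eq_zero _).mp h0)
    obtain ⟨c, hc⟩ := CharacterModule.exists_character_apply_ne_zero_of_ne_zero hne
    let χ : CharacterModule (LinearMap.ker f) := CharacterModule.opDual JK.mkQ c
    let φ : radQuot Rᵐᵒᵖ ⟶ charDual (ModuleCat.of R (LinearMap.ker f)) :=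
      ModuleCat.ofHom <| Submodule.liftQ _
        (LinearMap.toSpanSingleton Rᵐᵒᵖ (CharacterModule (LinearMap.ker f)) χ) <| by
          intro a ha
          refine CharacterModule.ext _ fun y => ?_
          have hy : JK.mkQ (a.unop • y) = 0 := (Submodule.Quotient.mk_eq_zero _).mpr
            (Submodule.smul_mem_smul (mem_jacobson_of_op_mem_jacobson ha) trivial)
          exact (congrArg c hy).trans (map_zero c)
    obtain ⟨y, hy⟩ := Ext.covariant_sequence_exact₃ _ (charDual_shortExact f hf)
      (Ext.mk₀ φ) rfl (Subsingleton.elim _ _)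
    obtain ⟨ψ, rfl⟩ := (Ext.mk₀_bijective _ _).2 y
    rw [Ext.mk₀_comp_mk₀] at hy
    have hy := (Ext.mk₀_bijective _ _).1 hy
    let e : radQuot Rᵐᵒᵖ := Submodule.Quotient.mk 1
    have hψ : CharacterModule.opDual (LinearMap.ker f).subtype (ψ e) = χ := by
      have h1 := ConcreteCategory.congr_hom hy e
      have h2 : φ.hom e = (1 : Rᵐᵒᵖ) • χ := rfl
      exact h1.trans (h2.trans (one_smul Rᵐᵒᵖ χ))
    have hvan : ∀ z ∈ Ring.jacobson R • (⊤ : Submodule R P),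
        (ψ e : CharacterModule P) z = 0 := by
      intro z hz
      induction hz using Submodule.smul_induction_on' with
      | smul a ha z _ =>
        have hae : op a • e = 0 := by
          rw [← Submodule.Quotient.mk_smul, Submodule.Quotient.mk_eq_zero, smul_eq_mul, mul_one]
          exact op_mem_jacobson_of_mem_jacobson ha
        have h2 : op a • ψ e = 0 := by
          rw [← map_smul, hae, map_zero]
        exact DFunLike.congr_fun h2 z
      | add z _ z' _ h h' => rw [map_add, h, h', add_zero]
    apply hc
    change χ x = 0
    rw [← hψ]
    exact hvan _ hx
  obtain ⟨r, hr⟩ := exists_leftInverse_of_jacobson_smul _ hrad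
  have hsplit : (Function.Injective (LinearMap.ker f).subtype ∧ ∃ s, f ∘ₗ s = LinearMap.id) ↔
      (Function.Surjective f ∧ ∃ l, l ∘ₗ (LinearMap.ker f).subtype = LinearMap.id) :=
    (LinearMap.exact_subtype_ker_map f).split_tfae'.out 0 1
  obtain ⟨-, s, hs⟩ := hsplit.mpr ⟨hf, r, hr⟩
  exact Module.Projective.of_split s f hs

/-- Over an artinian ring, the projective dimension of a module is detected by `Ext` from the
top of the ring into its character dual. -/
theorem pdimLE_of_subsingleton_ext [IsArtinianRing R] [IsArtinianRing Rᵐᵒᵖ] {n : ℕ}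
    {M : ModuleCat.{u} R} (hM : PdimLE R (n + 1) M)
    (h : Subsingleton (Ext (radQuot Rᵐᵒᵖ) (charDual M) (n + 1))) : PdimLE R n M := by
  induction n generalizing M with
  | zero =>
    obtain ⟨P, f, hP, hf, hK⟩ := hM
    have : Module.Projective R (LinearMap.ker f) := hK
    exact projective_of_subsingleton_ext_one f hf h
  | succ n ih =>
    obtain ⟨P, f, hP, hf, hK⟩ := hM
    have := injective_charDual P
    exact ⟨P, f, hP, hf, ih hK (subsingleton_ext_X₃_right (charDual_shortExact f hf) _ _
      (Ext.subsingleton_of_injective _ _ _) h)⟩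

section Syzygies

variable {T : ModuleCat.{u} R} (c : SyzygyChain R T)

theorem SyzygyChain.exists_shortExact (j : ℕ) :
    ∃ (i : c.Ω (j + 1) ⟶ c.P j) (p : c.P j ⟶ c.Ω j) (w : i ≫ p = 0),
      (ShortComplex.mk i p w).ShortExact := by
  obtain ⟨e⟩ := c.isoSucc j
  have hexact : Function.Exact ((LinearMap.ker (c.f j)).subtype ∘ₗ e.toLinearMap) (c.f j) := by
    rw [LinearMap.exact_iff, LinearMap.range_comp, LinearEquiv.range, Submodule.map_top,
      Submodule.range_subtype]
  exact ⟨_, _, _, ModuleCat.shortExact_of_exact _ _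
    ((Submodule.injective_subtype _).comp e.injective) (c.surj j) hexact⟩

theorem SyzygyChain.projective_P (j : ℕ) : Projective (c.P j) :=
  have := c.projective j
  ModuleCat.projective_of_categoryTheory_projective _

theorem SyzygyChain.subsingleton_ext {N : ModuleCat.{u} R} {d : ℕ}
    (hN : ∀ (X : ModuleCat.{u} R) (k : ℕ), d < k → Subsingleton (Ext X N k))
    (j k : ℕ) (hk : k ≠ 0) (hd : d < k + j) : Subsingleton (Ext (c.Ω j) N k) := by
  induction j generalizing k with
  | zero => exact hN _ _ hd
  | succ j ih =>
    obtain ⟨i, p, w, hS⟩ := c.exists_shortExact j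
    obtain ⟨k, rfl⟩ := Nat.exists_eq_succ_of_ne_zero hk
    have := c.projective_P j
    exact subsingleton_ext_X₁_left hS N _ (Ext.subsingleton_of_projective _ _ _)
      (ih _ (by lia) (by lia))

theorem SyzygyChain.not_subsingleton_ext {N : ModuleCat.{u} R} {d : ℕ}
    (hT : ¬ Subsingleton (Ext T N d)) (j k : ℕ) (hk : k ≠ 0) (hd : k + j = d) :
    ¬ Subsingleton (Ext (c.Ω j) N k) := by
  induction j generalizing k with
  | zero =>
    obtain rfl : k = d := hd
    obtain ⟨e⟩ := c.iso0
    exact fun h => hT (subsingleton_ext_of_retract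
      (Retract.ofIso e.symm.toModuleIso) N k h)
  | succ j ih =>
    obtain ⟨i, p, w, hS⟩ := c.exists_shortExact j
    have := c.projective_P j
    intro h
    exact ih (k + 1) k.succ_ne_zero (by lia)
      (subsingleton_ext_X₃_left hS N k h (Ext.subsingleton_of_projective _ _ _))

end Syzygies

/-- If `Ext` does not vanish on a finite direct sum, it does not vanish on one of the
summands. -/
theorem exists_retract_not_subsingleton_ext {s : ℕ} {A : Fin s → ModuleCat.{u} R}
    {m : Fin s → ℕ} {B : ModuleCat.{u} R} (e : ↥B ≃ₗ[R] ((i : Fin s) → Fin (m i) → ↥(A i)))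
    (N : ModuleCat.{u} R) (n : ℕ) (hB : ¬ Subsingleton (Ext B N n)) :
    ∃ i, Nonempty (Retract (A i) B) ∧ ¬ Subsingleton (Ext (A i) N n) := by
  let π (a : Σ i, Fin (m i)) : B ⟶ A a.1 := ModuleCat.ofHom
    (LinearMap.proj a.2 ∘ₗ LinearMap.proj (φ := fun i => Fin (m i) → ↥(A i)) a.1 ∘ₗ
      e.toLinearMap)
  let σ (a : Σ i, Fin (m i)) : A a.1 ⟶ B := ModuleCat.ofHom
    (e.symm.toLinearMap ∘ₗ LinearMap.single R (fun i => Fin (m i) → ↥(A i)) a.1 ∘ₗ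
      LinearMap.single R (fun _ => ↥(A a.1)) a.2)
  have hsum : ∑ a, π a ≫ σ a = 𝟙 B := by
    ext b
    obtain ⟨b, rfl⟩ := e.symm.surjective b
    have hb : ∑ a : Σ i, Fin (m i),
        (Pi.single a.1 (Pi.single a.2 (b a.1 a.2)) : (i : Fin s) → Fin (m i) → ↥(A i)) = b := by
      rw [Fintype.sum_sigma]
      conv_rhs => rw [← Finset.univ_sum_single b]
      refine Finset.sum_congr rfl fun i _ => ?_
      conv_rhs => rw [← Finset.univ_sum_single (b i)]
      exact (map_sum (LinearMap.single R (fun i => Fin (m i) → ↥(A i)) i) _ _).symm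
    conv_rhs => rw [← hb]
    simp [π, σ, ModuleCat.hom_sum]
  by_contra! hcon
  refine hB (subsingleton_ext_of_sum_eq_id (fun a : Σ i, Fin (m i) => A a.1) π σ hsum N n
    fun a => hcon a.1 ⟨⟨σ a, π a, ?_⟩⟩)
  ext x
  simp [π, σ]

end Ext

/-- Let `Λ` be an artinian ring with Jacobson radical `J`, and let
`T` be a right `Λ`-module of finite syzygy type in which `Λ/J` embeds.  If `s_m`
denotes the syzygy type of `Ω^m(T)`, then `l Fin dim Λ ≤ s_m + m` for all `m ≥ 0`. -/
theorem bigFinDim_le_syzygyType_shift (Λ : Type u) [Ring Λ]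
    [IsArtinianRing Λ] [IsArtinianRing Λᵐᵒᵖ]
    (T : ModuleCat.{u} Λᵐᵒᵖ) (cT : SyzygyChain Λᵐᵒᵖ T)
    (hemb : EmbedsIn Λᵐᵒᵖ (radQuot Λᵐᵒᵖ) T)
    (hfinType : ∃ (s : ℕ) (A : Fin s → ModuleCat.{u} Λᵐᵒᵖ), HasSyzygyType Λᵐᵒᵖ cT s A)
    (m sm : ℕ) (A : Fin sm → ModuleCat.{u} Λᵐᵒᵖ)
    (h : HasSyzygyType Λᵐᵒᵖ (SyzygyChain.shift Λᵐᵒᵖ cT m) sm A) :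
    bigFinDim Λ ≤ ((sm + m : ℕ) : ℕ∞) := by
  have key : ∀ (d : ℕ) (M : ModuleCat.{u} Λ), PdimLE Λ (d + 1) M → ¬ PdimLE Λ d M →
      d + 1 ≤ sm + m := by
    intro d M hM hM'
    have hvan : ∀ (X : ModuleCat.{u} Λᵐᵒᵖ) (k : ℕ), d + 1 < k →
        Subsingleton (Abelian.Ext X (charDual M) k) :=
      fun X k hk => subsingleton_ext_charDual hM X hk
    have hT : ¬ Subsingleton (Abelian.Ext T (charDual M) (d + 1)) := by
      intro hT
      obtain ⟨g, hg⟩ := hemb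
      refine hM' (pdimLE_of_subsingleton_ext hM ?_)
      have hS := ModuleCat.shortExact_of_exact g (C := ModuleCat.of Λᵐᵒᵖ (T ⧸ LinearMap.range g))
        (LinearMap.range g).mkQ hg (Submodule.mkQ_surjective _)
        (LinearMap.exact_map_mkQ_range g)
      exact subsingleton_ext_X₁_left hS _ _ hT (hvan _ _ (by lia))
    have hA : ∀ j : Fin (d + 1 - m), ∃ i, Nonempty (Retract (A i) (cT.Ω (m + j))) ∧
        ¬ Subsingleton (Abelian.Ext (A i) (charDual M) (d + 1 - m - j)) := by
      intro j
      obtain ⟨μ, ⟨e⟩⟩ := h.2.2.2 j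
      exact exists_retract_not_subsingleton_ext e _ _
        (cT.not_subsingleton_ext hT _ _ (by lia) (by lia))
    choose F hret hF using hA
    have hle : ∀ j j', F j = F j' → j' ≤ j := by
      intro j j' hjj
      by_contra! hlt
      obtain ⟨hr⟩ := hret j'
      rw [← hjj] at hr
      exact hF j (subsingleton_ext_of_retract hr _ _
        (cT.subsingleton_ext hvan _ _ (by lia) (by lia)))
    have hinj : Function.Injective F := fun j j' hjj =>
      le_antisymm (hle _ _ hjj.symm) (hle _ _ hjj)
    have := Fintype.card_le_of_injective F hinj
    simp only [Fintype.card_fin] at this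
    lia
  refine sSup_le ?_
  rintro _ ⟨hd, M, rfl⟩
  have hne : {d : ℕ∞ | ∃ n : ℕ, d = n ∧ PdimLE Λ n M}.Nonempty := by
    by_contra! hempty
    exact hd (by rw [pdim, hempty, sInf_empty])
  obtain ⟨n, hn, hnM⟩ := csInf_mem hne
  change pdim Λ M = n at hn
  rw [hn]
  cases n with
  | zero => simp
  | succ n =>
    refine Nat.cast_le.mpr (key n M hnM fun hn' => ?_)
    have hlt : pdim Λ M ≤ n := sInf_le ⟨n, rfl, hn'⟩
    rw [hn, Nat.cast_le] at hlt
    lia
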